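/- (Wiener's lemma for twisted convolution.) Let 0<p≤1, θ>0, and let ω be an admissible weight on ℤ^{2d} satisfying the weak growth condition. Let a ∈ ℓ^p(ℤ^{2d},ω) and suppose the twisted convolution operator L_a is invertible in B(ℓ²(ℤ^{2d})). Then there exists b ∈ ℓ^p(ℤ^{2d},ω) such that L_a^{-1} = L_b; equivalently, a⋆_θ b = b⋆_θ a = δ_0, where δ_0 is the sequence with δ_0(0,0)=1 and δ_0(m,n)=0 otherwise. -/

import Mathlib

open scoped ENNReal NNReal
open Filter

/-- Dot product on `ℤ^d`. -/
def zdot {d : ℕ} (u v : Fin d → ℤ) : ℤ := ∑ i, u i * v i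

/-- The character `x ↦ e^{2πiθx}`. -/
noncomputable def e2 (θ : ℝ) (x : ℤ) : ℂ :=
  Complex.exp (2 * Real.pi * Complex.I * θ * x)

/-- Twisted convolution on `ℤ^{2d} = ℤ^d × ℤ^d`:
`(a ⋆_θ b)(m,n) = Σ_{k,l} a(k,l) b(m−k,n−l) e^{2πiθ(m−k)·l}`. -/
noncomputable def tconv {d : ℕ} (θ : ℝ) (a b : (Fin d → ℤ) × (Fin d → ℤ) → ℂ) :
    (Fin d → ℤ) × (Fin d → ℤ) → ℂ :=
  fun mn => ∑' kl : (Fin d → ℤ) × (Fin d → ℤ),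
    a kl * b (mn - kl) * e2 θ (zdot (mn.1 - kl.1) kl.2)

/-- An admissible weight on `ℝ^{2d} = ℝ^d × ℝ^d`: `ω(x) = e^{ρ(|x|)}` for a norm `|·|` and
a continuous concave `ρ : [0,∞) → [0,∞)` with `ρ(0) = 0`, satisfying the GRS-condition. -/
def IsAdmissibleWeight2 {d : ℕ} (ω : (Fin d → ℝ) × (Fin d → ℝ) → ℝ) : Prop :=
  (∃ (N : (Fin d → ℝ) × (Fin d → ℝ) → ℝ) (ρ : ℝ → ℝ),
    (∀ x, 0 ≤ N x) ∧ (∀ x, N x = 0 ↔ x = 0) ∧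
    (∀ x y, N (x + y) ≤ N x + N y) ∧ (∀ (c : ℝ) (x), N (c • x) = |c| * N x) ∧
    ContinuousOn ρ (Set.Ici 0) ∧ ConcaveOn ℝ (Set.Ici 0) ρ ∧
    ρ 0 = 0 ∧ (∀ t : ℝ, 0 ≤ t → 0 ≤ ρ t) ∧
    (∀ x, ω x = Real.exp (ρ (N x)))) ∧
  (∀ x, Filter.Tendsto (fun n : ℕ => ω ((n : ℝ) • x) ^ ((n : ℝ)⁻¹)) Filter.atTop (nhds 1))

/-- The weak growth condition on `ℝ^{2d}`. -/
def WeakGrowth2 {d : ℕ} (ω : (Fin d → ℝ) × (Fin d → ℝ) → ℝ) : Prop :=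
  ∃ C : ℝ, 0 < C ∧ ∃ δ : ℝ, 0 < δ ∧ δ ≤ 1 ∧ ∀ x, C * (1 + ‖x‖) ^ δ ≤ ω x

/-- The canonical embedding `ℤ^{2d} → ℝ^{2d}`. -/
def zr2 {d : ℕ} (kl : (Fin d → ℤ) × (Fin d → ℤ)) : (Fin d → ℝ) × (Fin d → ℝ) :=
  (fun i => (kl.1 i : ℝ), fun i => (kl.2 i : ℝ))

theorem ENNReal.tsum_rpow_le_tsum_rpow {ι : Type*} {p : ℝ} (hp0 : 0 < p) (hp1 : p ≤ 1)
    (f : ι → ℝ≥0∞) : (∑' i, f i) ^ p ≤ ∑' i, f i ^ p := by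
  have hfin : ∀ s : Finset ι, (∑ i ∈ s, f i) ^ p ≤ ∑ i ∈ s, f i ^ p := by
    classical
    intro s
    induction s using Finset.induction_on with
    | empty => simp [hp0]
    | insert i s hi ih =>
      rw [Finset.sum_insert hi, Finset.sum_insert hi]
      exact (ENNReal.rpow_add_le_add_rpow _ _ hp0.le hp1).trans (by gcongr)
  have h : Tendsto (fun s : Finset ι => (∑ i ∈ s, f i) ^ p) atTop (nhds ((∑' i, f i) ^ p)) :=
    (ENNReal.continuous_rpow_const.tendsto _).comp ENNReal.summable.hasSum
  exact le_of_tendsto' h fun s => (hfin s).trans (ENNReal.sum_le_tsum s)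

section Gronwall

variable {G : Type*} [AddCommGroup G]

/-- The weighted `p`-sum of a positive convolution-type operator is controlled by the weighted
`p`-sum of its kernel. -/
theorem tsum_conv_rpow_mul_le {p : ℝ} (hp0 : 0 < p) (hp1 : p ≤ 1)
    (v k g : G → ℝ≥0∞) (hv1 : ∀ x, 1 ≤ v x) (hv : ∀ x y, v (x + y) ≤ v x * v y) :
    ∑' y, (∑' u, k u * (g y + g (y - u))) ^ p * v y
      ≤ 2 * (∑' u, k u ^ p * v u) * ∑' y, g y ^ p * v y := by
  calc ∑' y, (∑' u, k u * (g y + g (y - u))) ^ p * v y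
      ≤ ∑' y, ∑' u, k u ^ p * (g y ^ p + g (y - u) ^ p) * v y := by
        refine ENNReal.tsum_le_tsum fun y => ?_
        rw [ENNReal.tsum_mul_right]
        gcongr
        refine (ENNReal.tsum_rpow_le_tsum_rpow hp0 hp1 _).trans (ENNReal.tsum_le_tsum fun u => ?_)
        rw [ENNReal.mul_rpow_of_nonneg _ _ hp0.le]
        gcongr
        exact ENNReal.rpow_add_le_add_rpow _ _ hp0.le hp1
    _ = ∑' u, ∑' y, k u ^ p * (g y ^ p + g (y - u) ^ p) * v y := ENNReal.tsum_comm
    _ ≤ ∑' u, 2 * (k u ^ p * v u) * ∑' y, g y ^ p * v y := by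
        refine ENNReal.tsum_le_tsum fun u => ?_
        have h1 : ∑' y, g (y - u) ^ p * v y ≤ v u * ∑' y, g y ^ p * v y := by
          rw [← (Equiv.addRight u).tsum_eq, ← ENNReal.tsum_mul_left]
          refine ENNReal.tsum_le_tsum fun y => ?_
          simp only [Equiv.coe_addRight, add_sub_cancel_right]
          calc g y ^ p * v (y + u) ≤ g y ^ p * (v y * v u) := by gcongr; exact hv y u
            _ = v u * (g y ^ p * v y) := by ring
        have h2 : ∑' y, g y ^ p * v y ≤ v u * ∑' y, g y ^ p * v y :=
          le_mul_of_one_le_left (zero_le) (hv1 u)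
        calc ∑' y, k u ^ p * (g y ^ p + g (y - u) ^ p) * v y
            = k u ^ p * (∑' y, g y ^ p * v y + ∑' y, g (y - u) ^ p * v y) := by
              rw [← ENNReal.tsum_add, ← ENNReal.tsum_mul_left]
              exact tsum_congr fun y => by ring
          _ ≤ k u ^ p * (v u * ∑' y, g y ^ p * v y + v u * ∑' y, g y ^ p * v y) := by gcongr
          _ = 2 * (k u ^ p * v u) * ∑' y, g y ^ p * v y := by ring
    _ = 2 * (∑' u, k u ^ p * v u) * ∑' y, g y ^ p * v y := by
        rw [ENNReal.tsum_mul_right, ENNReal.tsum_mul_left]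

/-- A discrete Grönwall inequality: a bounded solution of `F ≤ h + A F`, with `A` a positive
convolution-type operator with small kernel, inherits the weighted `p`-summability of `h`. -/
theorem tsum_rpow_mul_le_of_le_add_conv {p : ℝ} (hp0 : 0 < p) (hp1 : p ≤ 1)
    (v k h F : G → ℝ≥0∞) (hv1 : ∀ x, 1 ≤ v x) (hvtop : ∀ x, v x ≠ ∞)
    (hv : ∀ x y, v (x + y) ≤ v x * v y)
    (hk : ∑' u, k u ^ p * v u ≤ 1 / 4) {B : ℝ≥0∞} (hB : B ≠ ∞) (hFB : ∀ y, F y ≤ B)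
    (hF : ∀ y, F y ≤ h y + ∑' u, k u * (F y + F (y - u))) :
    ∑' y, F y ^ p * v y ≤ 2 * ∑' y, h y ^ p * v y := by
  have hk1 : ∑' u, k u ≤ 1 / 4 := by
    refine le_trans (ENNReal.tsum_le_tsum fun u => ?_) hk
    have hu : k u ^ p * v u ≤ 1 := (ENNReal.le_tsum u).trans (hk.trans (by
      rw [one_div]; exact ENNReal.inv_le_one.2 (by norm_num)))
    have hup : k u ^ p ≤ k u ^ p * v u := le_mul_of_one_le_right (zero_le) (hv1 u)
    have hk1 : k u ≤ 1 := by
      by_contra hc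
      exact absurd (hup.trans hu) (not_le.2 (ENNReal.one_lt_rpow (not_le.1 hc) hp0))
    calc k u = k u ^ (1 : ℝ) := (ENNReal.rpow_one _).symm
      _ ≤ k u ^ p := ENNReal.rpow_le_rpow_of_exponent_ge hk1 hp1
      _ ≤ _ := hup
  let S : ℕ → G → ℝ≥0∞ := fun n =>
    Nat.rec 0 (fun _ s y => h y + ∑' u, k u * (s y + s (y - u))) n
  have hS : ∀ n y, S (n + 1) y = h y + ∑' u, k u * (S n y + S n (y - u)) := fun n y => rfl
  have hhalf : 2 * (1 / 4 : ℝ≥0∞) = 2⁻¹ := by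
    rw [show (4 : ℝ≥0∞) = 2 * 2 by norm_num, one_div,
      ENNReal.mul_inv (by simp) (by simp), ← mul_assoc, ENNReal.mul_inv_cancel (by simp) (by simp),
      one_mul]
  have hFS : ∀ n y, F y ≤ S n y + 2⁻¹ ^ n * B := by
    intro n
    induction n with
    | zero => intro y; simpa using (hFB y).trans le_add_self
    | succ n ih =>
      intro y
      calc F y ≤ h y + ∑' u, k u * (F y + F (y - u)) := hF y
        _ ≤ h y + ∑' u, (k u * (S n y + S n (y - u)) + k u * (2 * (2⁻¹ ^ n * B))) := by
          gcongr with u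
          calc k u * (F y + F (y - u))
              ≤ k u * ((S n y + 2⁻¹ ^ n * B) + (S n (y - u) + 2⁻¹ ^ n * B)) := by
                gcongr
                · exact ih y
                · exact ih (y - u)
            _ = _ := by ring
        _ = S (n + 1) y + 2 * (∑' u, k u) * (2⁻¹ ^ n * B) := by
          rw [ENNReal.tsum_add, ENNReal.tsum_mul_right, hS]; ring
        _ ≤ S (n + 1) y + 2 * (1 / 4) * (2⁻¹ ^ n * B) := by gcongr
        _ = S (n + 1) y + 2⁻¹ ^ (n + 1) * B := by rw [hhalf]; ring
  have hNS : ∀ n, ∑' y, S n y ^ p * v y ≤ 2 * ∑' y, h y ^ p * v y := by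
    intro n
    induction n with
    | zero => simp [S, hp0]
    | succ n ih =>
      calc ∑' y, S (n + 1) y ^ p * v y
          ≤ ∑' y, (h y ^ p * v y + (∑' u, k u * (S n y + S n (y - u))) ^ p * v y) := by
            refine ENNReal.tsum_le_tsum fun y => ?_
            rw [hS, ← add_mul]
            gcongr
            exact ENNReal.rpow_add_le_add_rpow _ _ hp0.le hp1
        _ ≤ ∑' y, h y ^ p * v y + 2 * (1 / 4) * (2 * ∑' y, h y ^ p * v y) := by
            rw [ENNReal.tsum_add]
            gcongr
            refine (tsum_conv_rpow_mul_le hp0 hp1 v k _ hv1 hv).trans ?_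
            gcongr
        _ = 2 * ∑' y, h y ^ p * v y := by
            rw [hhalf, ← mul_assoc, ENNReal.inv_mul_cancel (by simp) (by simp)]; ring
  rw [ENNReal.tsum_eq_iSup_sum]
  refine iSup_le fun s => ?_
  have hlim : Tendsto (fun n : ℕ => 2 * ∑' y, h y ^ p * v y + (2⁻¹ ^ n * B) ^ p * ∑ y ∈ s, v y)
      atTop (nhds (2 * ∑' y, h y ^ p * v y + 0)) := by
    refine Tendsto.const_add _ ?_
    have h0 : Tendsto (fun n : ℕ => (2⁻¹ : ℝ≥0∞) ^ n * B) atTop (nhds 0) := by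
      simpa using ENNReal.Tendsto.mul_const
        (ENNReal.tendsto_pow_atTop_nhds_zero_of_lt_one (r := 2⁻¹) (by simp)) (Or.inr hB)
    have h1 := (ENNReal.continuous_rpow_const (y := p)).tendsto 0 |>.comp h0
    rw [ENNReal.zero_rpow_of_pos hp0] at h1
    simpa using ENNReal.Tendsto.mul_const h1
      (Or.inr (ENNReal.sum_ne_top.2 fun y _ => hvtop y))
  rw [add_zero] at hlim
  refine ge_of_tendsto' hlim fun n => ?_
  calc ∑ y ∈ s, F y ^ p * v y
      ≤ ∑ y ∈ s, (S n y ^ p * v y + (2⁻¹ ^ n * B) ^ p * v y) := by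
        refine Finset.sum_le_sum fun y _ => ?_
        rw [← add_mul]
        gcongr
        exact (ENNReal.rpow_le_rpow (hFS n y) hp0.le).trans
          (ENNReal.rpow_add_le_add_rpow _ _ hp0.le hp1)
    _ = ∑ y ∈ s, S n y ^ p * v y + (2⁻¹ ^ n * B) ^ p * ∑ y ∈ s, v y := by
        rw [Finset.sum_add_distrib, Finset.mul_sum]
    _ ≤ _ := by gcongr; exact (ENNReal.sum_le_tsum s).trans (hNS n)

end Gronwall

theorem abs_exp_neg_sub_exp_neg_le (s t : ℝ) :
    |Real.exp (-s) - Real.exp (-t)| ≤ min 1 |s - t| * (Real.exp (-s) + Real.exp (-t)) := by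
  wlog h : s ≤ t generalizing s t
  · rw [abs_sub_comm, abs_sub_comm s t, add_comm]
    exact this t s (le_of_not_ge h)
  have h1 : Real.exp (-s) - Real.exp (-t) = Real.exp (-s) * (1 - Real.exp (-(t - s))) := by
    rw [mul_sub, ← Real.exp_add]; ring_nf
  have h2 : 0 ≤ 1 - Real.exp (-(t - s)) := by
    rw [sub_nonneg, Real.exp_le_one_iff]; linarith
  have h3 : 1 - Real.exp (-(t - s)) ≤ min 1 |s - t| := by
    refine le_min ?_ ?_
    · linarith [Real.exp_pos (-(t - s))]
    · rw [abs_sub_comm, abs_of_nonneg (sub_nonneg.2 h)]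
      linarith [Real.add_one_le_exp (-(t - s))]
  rw [h1, abs_of_nonneg (mul_nonneg (Real.exp_pos _).le h2), mul_comm]
  exact mul_le_mul h3 (le_add_of_nonneg_right (Real.exp_pos _).le) (Real.exp_pos _).le
    (by positivity)

theorem lp.exists_of_norm_le_comp {G : Type*} (h : lp (fun _ : G => ℂ) 2) (e : G ≃ G) (g : G → ℂ)
    (hg : ∀ x, ‖g x‖ ≤ ‖h (e x)‖) :
    ∃ g' : lp (fun _ : G => ℂ) 2, (∀ x, g' x = g x) ∧ ‖g'‖ ≤ ‖h‖ := by
  have h2 : (0 : ℝ) < (2 : ℝ≥0∞).toReal := by simp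
  have hs := (e.summable_iff (f := fun x => ‖h x‖ ^ (2 : ℝ≥0∞).toReal)).2 ((lp.memℓp h).summable h2)
  have hle : ∀ x, ‖g x‖ ^ (2 : ℝ≥0∞).toReal ≤ ‖h (e x)‖ ^ (2 : ℝ≥0∞).toReal :=
    fun x => Real.rpow_le_rpow (norm_nonneg _) (hg x) h2.le
  have hgs : Summable fun x => ‖g x‖ ^ (2 : ℝ≥0∞).toReal :=
    Summable.of_nonneg_of_le (fun x => by positivity) hle hs
  refine ⟨⟨g, memℓp_gen hgs⟩, fun x => rfl, ?_⟩
  refine lp.norm_le_of_tsum_le h2 (norm_nonneg _) ?_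
  rw [lp.norm_rpow_eq_tsum h2, ← e.tsum_eq fun x => ‖h x‖ ^ (2 : ℝ≥0∞).toReal]
  exact hgs.tsum_le_tsum hle hs

theorem summable_norm_of_summable_rpow_mul {G : Type*} {p : ℝ} (hp0 : 0 < p) (hp1 : p ≤ 1)
    {w : G → ℝ} (hw1 : ∀ x, 1 ≤ w x) {a : G → ℂ}
    (ha : Summable fun u => ‖a u‖ ^ p * w u ^ p) : Summable fun u => ‖a u‖ := by
  refine Summable.of_norm_bounded_eventually ha ?_
  filter_upwards [ha.tendsto_cofinite_zero.eventually (ge_mem_nhds zero_lt_one)] with u hu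
  have h1 : ‖a u‖ ^ p ≤ ‖a u‖ ^ p * w u ^ p :=
    le_mul_of_one_le_right (by positivity) (Real.one_le_rpow (hw1 u) hp0.le)
  have h2 : ‖a u‖ ≤ 1 := by
    by_contra hc
    exact absurd (h1.trans hu) (not_le.2 (Real.one_lt_rpow (not_le.1 hc) hp0))
  rw [norm_norm]
  refine le_trans ?_ h1
  conv_lhs => rw [← Real.rpow_one ‖a u‖]
  exact Real.rpow_le_rpow_of_exponent_ge' (norm_nonneg _) h2 hp0.le hp1

section Localization

variable {G : Type*} [AddCommGroup G]

/-- Localized norm estimate: multiplying by the exponential bump `x ↦ e^{-ε |x - y|}` commutes with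
a convolution-dominated operator up to a small convolution-type error. -/
theorem norm_bump_mul_le [DecidableEq G] {len : G → ℝ}
    (hlen0 : len 0 = 0) (hlenneg : ∀ x, len (-x) = len x)
    (hlen : ∀ x y, len (x + y) ≤ len x + len y)
    {σ : G → G → ℂ} (hσ : ∀ x u, ‖σ x u‖ = 1) {a : G → ℂ} (ha : Summable fun u => ‖a u‖)
    {T : lp (fun _ : G => ℂ) 2 →L[ℂ] lp (fun _ : G => ℂ) 2}
    (hT : ∀ f x, T f x = ∑' u, a u * f (x - u) * σ x u)
    {C : ℝ} (hC : 0 ≤ C) (hTC : ∀ g, ‖g‖ ≤ C * ‖T g‖)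
    {f : lp (fun _ : G => ℂ) 2} (hf : T f = lp.single 2 0 1) {ε : ℝ} (hε : 0 < ε)
    (fb : G → lp (fun _ : G => ℂ) 2)
    (hfb : ∀ y x, fb y x = (Real.exp (-(ε * len (x - y))) : ℂ) * f x) (M : ℝ) (hM : ∀ y, ‖fb y‖ ≤ M)
    (y : G) :
    (Summable fun u => C * (‖a u‖ * min 1 (ε * len u)) * (‖fb y‖ + ‖fb (y - u)‖)) ∧
    ‖fb y‖ ≤ C * Real.exp (-(ε * len y)) +
      ∑' u, C * (‖a u‖ * min 1 (ε * len u)) * (‖fb y‖ + ‖fb (y - u)‖) := by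
  have hlenn : ∀ x, 0 ≤ len x := fun x => by
    have := hlen x (-x); rw [add_neg_cancel, hlen0, hlenneg] at this; linarith
  have hlensub : ∀ x u, |len x - len (x - u)| ≤ len u := fun x u => by
    have h1 := hlen (x - u) u
    have h2 := hlen x (-u)
    rw [sub_add_cancel] at h1
    rw [hlenneg, ← sub_eq_add_neg] at h2
    rw [abs_le]; constructor <;> linarith
  set φ : G → ℝ := fun x => Real.exp (-(ε * len x)) with hφ
  have hfb' : ∀ y x, fb y x = (φ (x - y) : ℂ) * f x := fun y x => by rw [hfb]
  have hφpos : ∀ x, 0 < φ x := fun x => Real.exp_pos _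
  have hm0 : ∀ u, 0 ≤ min 1 (ε * len u) := fun u => le_min zero_le_one (mul_nonneg hε.le (hlenn u))
  have hφsub : ∀ x u, |φ (x - u) - φ x| ≤ min 1 (ε * len u) * (φ (x - u) + φ x) := fun x u => by
    refine (abs_exp_neg_sub_exp_neg_le _ _).trans ?_
    refine mul_le_mul_of_nonneg_right (min_le_min_left _ ?_) (add_pos (hφpos _) (hφpos _)).le
    rw [← mul_sub, abs_mul, abs_of_pos hε, abs_sub_comm]
    exact mul_le_mul_of_nonneg_left (hlensub x u) hε.le
  have hD : ∀ u, ∃ D : lp (fun _ : G => ℂ) 2,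
      (∀ x, D x = a u * ((φ (x - u - y) - φ (x - y) : ℝ) * f (x - u)) * σ x u) ∧
      ‖D‖ ≤ ‖a u‖ * min 1 (ε * len u) * (‖fb y‖ + ‖fb (y - u)‖) := by
    intro u
    obtain ⟨D, hD1, hD2⟩ := lp.exists_of_norm_le_comp
      (((‖a u‖ * min 1 (ε * len u) : ℝ) : ℂ) • (fb y + fb (y - u))) (Equiv.subRight u)
      (fun x => a u * ((φ (x - u - y) - φ (x - y) : ℝ) * f (x - u)) * σ x u) (fun x => by
        have h1 : φ (x - u - (y - u)) = φ (x - y) := by congr 1; abel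
        have h2 : φ (x - y - u) = φ (x - u - y) := by congr 1; abel
        have h3 := hφsub (x - y) u
        rw [h2] at h3
        rw [lp.coeFn_smul, Pi.smul_apply, lp.coeFn_add, Pi.add_apply, Equiv.subRight_apply, hfb',
          hfb', h1, ← add_mul, norm_smul, norm_mul, norm_mul, norm_mul, norm_mul, hσ, mul_one,
          Complex.norm_real, Complex.norm_real, ← Complex.ofReal_add, Complex.norm_real,
          Real.norm_of_nonneg (mul_nonneg (norm_nonneg _) (hm0 u)),
          Real.norm_of_nonneg (add_pos (hφpos _) (hφpos _)).le, mul_assoc, ← mul_assoc (min _ _)]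
        gcongr
        exact h3)
    refine ⟨D, hD1, hD2.trans ?_⟩
    rw [norm_smul, Complex.norm_real, Real.norm_of_nonneg (mul_nonneg (norm_nonneg _) (hm0 u))]
    exact mul_le_mul_of_nonneg_left (norm_add_le _ _) (mul_nonneg (norm_nonneg _) (hm0 u))
  choose D hD1 hD2 using hD
  have hsum : Summable fun u => ‖a u‖ * min 1 (ε * len u) * (‖fb y‖ + ‖fb (y - u)‖) := by
    refine Summable.of_nonneg_of_le (fun u => ?_) (fun u => ?_) (ha.mul_right (M + M))
    · exact mul_nonneg (mul_nonneg (norm_nonneg _) (hm0 u)) (by positivity)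
    · refine mul_le_mul ?_ (add_le_add (hM _) (hM _)) (by positivity) (norm_nonneg _)
      exact mul_le_of_le_one_right (norm_nonneg _) (min_le_left _ _)
  have hDs : Summable D := Summable.of_norm_bounded hsum hD2
  have heq : T (fb y) = ∑' u, D u + ((φ y : ℝ) : ℂ) • lp.single 2 0 1 := by
    apply lp.ext
    funext x
    have hev : (∑' u, D u : lp (fun _ : G => ℂ) 2) x = ∑' u, D u x := by
      have hc : Continuous fun g : lp (fun _ : G => ℂ) 2 => g x :=
        (lp.lipschitzWith_one_eval 2 x).continuous
      exact (hDs.hasSum.map (⟨⟨fun g : lp (fun _ : G => ℂ) 2 => g x, rfl⟩, fun _ _ => rfl⟩ :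
        lp (fun _ : G => ℂ) 2 →+ ℂ) hc).tsum_eq.symm
    have hevs : Summable fun u => D u x := by
      refine Summable.of_norm_bounded hsum fun u => ?_
      exact (lp.norm_apply_le_norm (by simp) _ _).trans (hD2 u)
    have hTs : Summable fun u => a u * f (x - u) * σ x u := by
      refine Summable.of_norm_bounded (ha.mul_right ‖f‖) fun u => ?_
      rw [norm_mul, norm_mul, hσ, mul_one]
      exact mul_le_mul_of_nonneg_left (lp.norm_apply_le_norm (by simp) _ _) (norm_nonneg _)
    have hlast : (φ (x - y) : ℂ) * T f x =
        ((φ y : ℝ) : ℂ) * (lp.single 2 (0 : G) (1 : ℂ) : lp (fun _ : G => ℂ) 2) x := by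
      rw [hf]
      rcases eq_or_ne x 0 with rfl | hx
      · simp only [hφ, zero_sub, hlenneg]
      · rw [lp.single_apply_ne 2 0 _ hx]; simp
    rw [lp.coeFn_add, Pi.add_apply, hev, lp.coeFn_smul, Pi.smul_apply, smul_eq_mul, ← hlast, hT, hT,
      ← tsum_mul_left, ← hevs.tsum_add (hTs.mul_left _)]
    refine tsum_congr fun u => ?_
    rw [hD1, hfb']
    push_cast
    ring
  have hnorm : ‖T (fb y)‖ ≤ φ y + ∑' u, ‖a u‖ * min 1 (ε * len u) * (‖fb y‖ + ‖fb (y - u)‖) := by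
    rw [heq, add_comm]
    refine (norm_add_le _ _).trans (add_le_add ?_ (tsum_of_norm_bounded hsum.hasSum hD2))
    rw [norm_smul, lp.norm_single (by simp), Complex.norm_real, norm_one, mul_one,
      Real.norm_of_nonneg (hφpos _).le]
  simp only [mul_assoc] at hsum hnorm ⊢
  refine ⟨hsum.mul_left C, ?_⟩
  rw [tsum_mul_left, ← mul_add]
  exact (hTC _).trans (mul_le_mul_of_nonneg_left hnorm hC)

/-- The `ℓ²`-preimage of a point mass under a convolution-dominated operator which is bounded below
has the same weighted `p`-summability as the dominating sequence. -/
theorem summable_rpow_mul_of_apply_eq_single [DecidableEq G] {p : ℝ} (hp0 : 0 < p) (hp1 : p ≤ 1)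
    {len w : G → ℝ} (hlen0 : len 0 = 0) (hlenneg : ∀ x, len (-x) = len x)
    (hlen : ∀ x y, len (x + y) ≤ len x + len y)
    (hw1 : ∀ x, 1 ≤ w x) (hw : ∀ x y, w (x + y) ≤ w x * w y)
    (hwexp : ∀ ε > 0, Summable fun x => Real.exp (-(ε * len x)) ^ p * w x ^ p)
    {σ : G → G → ℂ} (hσ : ∀ x u, ‖σ x u‖ = 1) {a : G → ℂ}
    (ha : Summable fun u => ‖a u‖ ^ p * w u ^ p)
    {T : lp (fun _ : G => ℂ) 2 →L[ℂ] lp (fun _ : G => ℂ) 2}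
    (hT : ∀ f x, T f x = ∑' u, a u * f (x - u) * σ x u)
    {C : ℝ} (hC : 0 ≤ C) (hTC : ∀ g, ‖g‖ ≤ C * ‖T g‖)
    {f : lp (fun _ : G => ℂ) 2} (hf : T f = lp.single 2 0 1) :
    Summable fun u => ‖f u‖ ^ p * w u ^ p := by
  have hlenn : ∀ x, 0 ≤ len x := fun x => by
    have := hlen x (-x); rw [add_neg_cancel, hlen0, hlenneg] at this; linarith
  have hw0 : ∀ x, 0 ≤ w x := fun x => zero_le_one.trans (hw1 x)
  obtain ⟨ε, hε, hsmall⟩ : ∃ ε : ℝ, 0 < ε ∧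
      ∑' u, (C * (‖a u‖ * min 1 (ε * len u))) ^ p * w u ^ p ≤ 1 / 4 := by
    have hlim : Tendsto (fun ε : ℝ => ∑' u, (C * (‖a u‖ * min 1 (ε * len u))) ^ p * w u ^ p)
        (nhdsWithin 0 (Set.Ioi 0)) (nhds (∑' _ : G, 0)) := by
      refine tendsto_tsum_of_dominated_convergence (ha.mul_left (C ^ p)) (fun u => ?_) ?_
      · have hc : Continuous fun ε : ℝ => (C * (‖a u‖ * min 1 (ε * len u))) ^ p * w u ^ p :=
          ((Real.continuous_rpow_const hp0.le).comp (by fun_prop)).mul continuous_const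
        have := hc.tendsto 0
        simp only [zero_mul, min_eq_right zero_le_one, mul_zero, Real.zero_rpow hp0.ne'] at this
        exact this.mono_left nhdsWithin_le_nhds
      · filter_upwards [self_mem_nhdsWithin] with ε hε u
        have hm0 : 0 ≤ min 1 (ε * len u) :=
          le_min zero_le_one (mul_nonneg (le_of_lt hε) (hlenn u))
        have := hw0 u
        rw [Real.norm_of_nonneg (by positivity), ← mul_assoc (C ^ p),
          ← Real.mul_rpow hC (norm_nonneg _)]
        gcongr
        exact mul_le_of_le_one_right (norm_nonneg _) (min_le_left _ _)
    rw [tsum_zero] at hlim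
    obtain ⟨ε, h1, h2⟩ := ((hlim.eventually (ge_mem_nhds (by norm_num : (0 : ℝ) < 1 / 4))).and
      self_mem_nhdsWithin).exists
    exact ⟨ε, h2, h1⟩
  have hm0 : ∀ u, 0 ≤ min 1 (ε * len u) := fun u => le_min zero_le_one (mul_nonneg hε.le (hlenn u))
  have hfb : ∀ y, ∃ g : lp (fun _ : G => ℂ) 2,
      (∀ x, g x = (Real.exp (-(ε * len (x - y))) : ℂ) * f x) ∧ ‖g‖ ≤ ‖f‖ := fun y => by
    refine lp.exists_of_norm_le_comp f (Equiv.refl G) _ fun x => ?_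
    rw [norm_mul, Complex.norm_real, Real.norm_of_nonneg (Real.exp_pos _).le]
    refine mul_le_of_le_one_left (norm_nonneg _) (Real.exp_le_one_iff.2 ?_)
    have := mul_nonneg hε.le (hlenn (x - y)); linarith
  choose fb hfb hfbf using hfb
  have hmain := norm_bump_mul_le hlen0 hlenneg hlen hσ
    (summable_norm_of_summable_rpow_mul hp0 hp1 hw1 ha) hT hC hTC hf hε fb
    (fun y x => by rw [hfb]) ‖f‖ hfbf
  have hkn : ∀ u, 0 ≤ C * (‖a u‖ * min 1 (ε * len u)) := fun u =>
    mul_nonneg hC (mul_nonneg (norm_nonneg _) (hm0 u))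
  have hconv : ∀ {g : G → ℝ}, (∀ x, 0 ≤ g x) → ∀ x,
      ENNReal.ofReal (g x) ^ p * ENNReal.ofReal (w x ^ p) = ENNReal.ofReal (g x ^ p * w x ^ p) :=
    fun hg x => by
      rw [ENNReal.ofReal_rpow_of_nonneg (hg x) hp0.le,
        ENNReal.ofReal_mul (Real.rpow_nonneg (hg x) _)]
  have hgron := tsum_rpow_mul_le_of_le_add_conv hp0 hp1 (fun x => ENNReal.ofReal (w x ^ p))
    (fun u => ENNReal.ofReal (C * (‖a u‖ * min 1 (ε * len u))))
    (fun y => ENNReal.ofReal (C * Real.exp (-(ε * len y))))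
    (fun y => ENNReal.ofReal ‖fb y‖)
    (fun x => ENNReal.one_le_ofReal.2 (Real.one_le_rpow (hw1 x) hp0.le))
    (fun x => ENNReal.ofReal_ne_top)
    (fun x y => by
      rw [← ENNReal.ofReal_mul (Real.rpow_nonneg (hw0 x) _), ← Real.mul_rpow (hw0 x) (hw0 y)]
      exact ENNReal.ofReal_le_ofReal (Real.rpow_le_rpow (hw0 _) (hw x y) hp0.le))
    (by
      simp only [hconv hkn]
      rw [← ENNReal.ofReal_tsum_of_nonneg]
      · refine (ENNReal.ofReal_le_ofReal hsmall).trans_eq ?_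
        rw [ENNReal.ofReal_div_of_pos (by norm_num)]; simp
      · exact fun u => mul_nonneg (Real.rpow_nonneg (hkn u) _) (Real.rpow_nonneg (hw0 u) _)
      · refine Summable.of_nonneg_of_le
          (fun u => mul_nonneg (Real.rpow_nonneg (hkn u) _) (Real.rpow_nonneg (hw0 u) _))
          (fun u => ?_) (ha.mul_left (C ^ p))
        have := hw0 u
        rw [← mul_assoc (C ^ p), ← Real.mul_rpow hC (norm_nonneg _)]
        gcongr
        · exact hkn u
        · exact mul_le_of_le_one_right (norm_nonneg _) (min_le_left _ _))
    (ENNReal.ofReal_ne_top (r := ‖f‖)) (fun y => ENNReal.ofReal_le_ofReal (hfbf y))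
    (fun y => by
      have hterm : ∀ u, 0 ≤ C * (‖a u‖ * min 1 (ε * len u)) * (‖fb y‖ + ‖fb (y - u)‖) :=
        fun u => mul_nonneg (hkn u) (by positivity)
      simp only [← ENNReal.ofReal_add (norm_nonneg _) (norm_nonneg _),
        ← ENNReal.ofReal_mul (hkn _)]
      rw [← ENNReal.ofReal_tsum_of_nonneg hterm (hmain y).1,
        ← ENNReal.ofReal_add (by positivity) (tsum_nonneg hterm)]
      exact ENNReal.ofReal_le_ofReal (hmain y).2)
  have hH : Summable fun y => (C * Real.exp (-(ε * len y))) ^ p * w y ^ p := by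
    simp only [Real.mul_rpow hC (Real.exp_pos _).le, mul_assoc]
    exact (hwexp ε hε).mul_left _
  have hHn : ∀ y, 0 ≤ C * Real.exp (-(ε * len y)) := fun y => by positivity
  simp only [hconv hHn, hconv (fun y => norm_nonneg (fb y))] at hgron
  rw [← ENNReal.ofReal_tsum_of_nonneg
    (fun y => mul_nonneg (Real.rpow_nonneg (hHn y) _) (Real.rpow_nonneg (hw0 y) _)) hH] at hgron
  have hfin : ∑' y, ENNReal.ofReal (‖fb y‖ ^ p * w y ^ p) ≠ ∞ :=
    ne_top_of_le_ne_top (ENNReal.mul_ne_top (by simp) ENNReal.ofReal_ne_top) hgron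
  have hfbn : ∀ y, 0 ≤ ‖fb y‖ ^ p * w y ^ p := fun y =>
    mul_nonneg (by positivity) (Real.rpow_nonneg (hw0 y) _)
  have hfbs : Summable fun y => ‖fb y‖ ^ p * w y ^ p := by
    have := ENNReal.summable_toReal hfin
    simpa only [ENNReal.toReal_ofReal (hfbn _)] using this
  refine Summable.of_nonneg_of_le
    (fun u => mul_nonneg (by positivity) (Real.rpow_nonneg (hw0 u) _)) (fun u => ?_) hfbs
  have h1 : fb u u = f u := by rw [hfb]; simp [hlen0]
  have := hw0 u
  gcongr
  rw [← h1]
  exact lp.norm_apply_le_norm (by simp) _ _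

end Localization

section Weight

theorem ConcaveOn.monotoneOn_of_nonneg {ρ : ℝ → ℝ} (hρ : ConcaveOn ℝ (Set.Ici 0) ρ)
    (hnn : ∀ t, 0 ≤ t → 0 ≤ ρ t) : MonotoneOn ρ (Set.Ici 0) := by
  intro s hs t ht hst
  by_contra! hlt
  have hst' : s < t := lt_of_le_of_ne hst (by rintro rfl; exact lt_irrefl _ hlt)
  have hts : 0 < t - s := sub_pos.2 hst'
  set m := (ρ s - ρ t) / (t - s) with hm
  have hmpos : 0 < m := div_pos (sub_pos.2 hlt) hts
  have ht0 : 0 ≤ ρ t := hnn t ht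
  have hr : 0 < (ρ t + 1) / m := by positivity
  have hrmem : t + (ρ t + 1) / m ∈ Set.Ici (0 : ℝ) := add_nonneg ht hr.le
  have h := hρ.slope_anti_adjacent hs hrmem hst' (lt_add_of_pos_right t hr)
  rw [add_sub_cancel_left, div_le_iff₀ hr, show (ρ t - ρ s) / (t - s) = -m by rw [hm]; ring,
    neg_mul, mul_div_cancel₀ _ hmpos.ne'] at h
  linarith [hnn _ hrmem]

theorem ConcaveOn.add_le_of_map_zero {ρ : ℝ → ℝ} (hρ : ConcaveOn ℝ (Set.Ici 0) ρ) (h0 : ρ 0 = 0)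
    {s t : ℝ} (hs : 0 ≤ s) (ht : 0 ≤ t) : ρ (s + t) ≤ ρ s + ρ t := by
  rcases (add_nonneg hs ht).eq_or_lt with hst | hst
  · have h1 : s = 0 := by linarith
    have h2 : t = 0 := by linarith
    simp [h1, h2, h0]
  have key : ∀ x y : ℝ, 0 ≤ x → 0 ≤ y → x + y = s + t → x / (s + t) * ρ (s + t) ≤ ρ x := by
    intro x y hx hy hxy
    have h := hρ.2 (Set.mem_Ici.2 hst.le) (Set.mem_Ici.2 le_rfl) (div_nonneg hx hst.le)
      (div_nonneg hy hst.le) (by rw [← add_div, hxy, div_self hst.ne'])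
    simp only [smul_eq_mul, h0, mul_zero, add_zero] at h
    rwa [div_mul_cancel₀ _ hst.ne'] at h
  have h1 := key s t hs ht rfl
  have h2 := key t s ht hs (add_comm _ _)
  have h3 : s / (s + t) * ρ (s + t) + t / (s + t) * ρ (s + t) = ρ (s + t) := by
    rw [← add_mul, ← add_div, div_self hst.ne', one_mul]
  linarith

/-- A concave function with vanishing mean growth along an arithmetic progression is dominated by
every linear function, up to a constant. -/
theorem exists_le_mul_add_of_tendsto {ρ : ℝ → ℝ} (hmono : MonotoneOn ρ (Set.Ici 0)) {c : ℝ}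
    (hc : 0 < c) (hlim : Tendsto (fun n : ℕ => ρ (n * c) / n) atTop (nhds 0)) {η : ℝ} (hη : 0 < η) :
    ∃ C, ∀ t, 0 ≤ t → ρ t ≤ η * t + C := by
  obtain ⟨n₀, hn₀⟩ := eventually_atTop.1 (hlim.eventually (ge_mem_nhds (mul_pos hη hc)))
  refine ⟨η * c * (n₀ + 2), fun t ht => ?_⟩
  set n := ⌈t / c⌉₊ + n₀ + 1 with hn
  have hn1 : t / c ≤ n := (Nat.le_ceil _).trans (by exact_mod_cast (by omega))
  have hn2 : (n : ℝ) ≤ t / c + (n₀ + 2) := by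
    have := (Nat.ceil_lt_add_one (div_nonneg ht hc.le)).le
    rw [hn]; push_cast; linarith
  have hnpos : (0 : ℝ) < n := by positivity
  have h1 : ρ (n * c) ≤ η * c * n := (div_le_iff₀ hnpos).1 (hn₀ n (by omega))
  calc ρ t ≤ ρ (n * c) := hmono ht (Set.mem_Ici.2 (by positivity)) ((div_le_iff₀ hc).1 hn1)
    _ ≤ η * c * n := h1
    _ ≤ η * c * (t / c + (n₀ + 2)) := by gcongr
    _ = η * t + η * c * (n₀ + 2) := by field_simp

/-- The `ℓ¹`-length on `ℤ^{2d}`. -/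
def zlen {d : ℕ} (x : (Fin d → ℤ) × (Fin d → ℤ)) : ℝ := ∑ i, |(x.1 i : ℝ)| + ∑ i, |(x.2 i : ℝ)|

theorem zlen_nonneg {d : ℕ} (x : (Fin d → ℤ) × (Fin d → ℤ)) : 0 ≤ zlen x := by
  unfold zlen; positivity

theorem zlen_add_le {d : ℕ} (x y : (Fin d → ℤ) × (Fin d → ℤ)) :
    zlen (x + y) ≤ zlen x + zlen y := by
  have h : ∀ u v : Fin d → ℤ, ∑ i, |((u + v) i : ℝ)| ≤ ∑ i, |(u i : ℝ)| + ∑ i, |(v i : ℝ)| :=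
    fun u v => by
      rw [← Finset.sum_add_distrib]
      exact Finset.sum_le_sum fun i _ => by simpa using abs_add_le (u i : ℝ) (v i)
  have h1 := h x.1 y.1
  have h2 := h x.2 y.2
  simp only [zlen, Prod.fst_add, Prod.snd_add]
  linarith

theorem summable_prod_pi_of_nonneg {f : ℤ → ℝ} (hf0 : ∀ k, 0 ≤ f k) (hf : Summable f) (d : ℕ) :
    Summable fun x : Fin d → ℤ => ∏ i, f (x i) := by
  induction d with
  | zero => exact Summable.of_finite
  | succ d ih =>
    rw [← (Fin.consEquiv fun _ : Fin (d + 1) => ℤ).summable_iff]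
    refine (hf.mul_of_nonneg ih hf0 fun x => Finset.prod_nonneg fun i _ => hf0 _).congr fun x => ?_
    simp [Fin.prod_univ_succ, Fin.consEquiv]

theorem summable_exp_neg_mul_zlen {d : ℕ} {c : ℝ} (hc : 0 < c) :
    Summable fun x : (Fin d → ℤ) × (Fin d → ℤ) => Real.exp (-(c * zlen x)) := by
  have hnat : Summable fun n : ℕ => Real.exp (n * -c) :=
    Real.summable_exp_nat_mul_iff.2 (neg_lt_zero.2 hc)
  have hint : Summable fun k : ℤ => Real.exp (-(c * |(k : ℝ)|)) := by
    refine Summable.of_nat_of_neg ?_ ?_ <;>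
    · refine hnat.congr fun n => ?_
      simp [mul_comm]
  have hpi := summable_prod_pi_of_nonneg (fun k => (Real.exp_pos _).le) hint d
  refine (hpi.mul_of_nonneg hpi (fun x => by positivity) (fun x => by positivity)).congr fun x => ?_
  rw [← Real.exp_sum, ← Real.exp_sum, ← Real.exp_add, zlen, mul_add, neg_add, Finset.mul_sum,
    Finset.mul_sum, Finset.sum_neg_distrib, Finset.sum_neg_distrib]

theorem exists_le_mul_zlen {d : ℕ} {N : (Fin d → ℝ) × (Fin d → ℝ) → ℝ}
    (hNadd : ∀ x y, N (x + y) ≤ N x + N y) (hNsmul : ∀ (c : ℝ) x, N (c • x) = |c| * N x)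
    (hN0 : ∀ x, 0 ≤ N x) : ∃ B, 0 < B ∧ ∀ x : (Fin d → ℤ) × (Fin d → ℤ), N (zr2 x) ≤ B * zlen x := by
  set B := ∑ i : Fin d, N (Pi.single i 1, 0) + ∑ i : Fin d, N (0, Pi.single i 1) with hB
  have hB1 : ∀ i : Fin d, N (Pi.single i 1, 0) ≤ B + 1 := fun i => by
    have h1 := Finset.single_le_sum (f := fun i : Fin d => N (Pi.single i 1, 0))
      (fun i _ => hN0 _) (Finset.mem_univ i)
    have h2 : 0 ≤ ∑ i : Fin d, N (0, Pi.single i 1) := Finset.sum_nonneg fun i _ => hN0 _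
    linarith
  have hB2 : ∀ i : Fin d, N (0, Pi.single i 1) ≤ B + 1 := fun i => by
    have h1 := Finset.single_le_sum (f := fun i : Fin d => N (0, Pi.single i 1))
      (fun i _ => hN0 _) (Finset.mem_univ i)
    have h2 : 0 ≤ ∑ i : Fin d, N (Pi.single i 1, 0) := Finset.sum_nonneg fun i _ => hN0 _
    linarith
  have hN00 : N 0 = 0 := by simpa using hNsmul 0 0
  refine ⟨B + 1, add_pos_of_nonneg_of_pos (add_nonneg (Finset.sum_nonneg fun i _ => hN0 _)
    (Finset.sum_nonneg fun i _ => hN0 _)) one_pos, fun x => ?_⟩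
  have hx : zr2 x = ∑ i, (x.1 i : ℝ) • ((Pi.single i 1, 0) : (Fin d → ℝ) × (Fin d → ℝ)) +
      ∑ i, (x.2 i : ℝ) • ((0, Pi.single i 1) : (Fin d → ℝ) × (Fin d → ℝ)) := by
    refine Prod.ext ?_ ?_ <;> funext j <;>
      simp [zr2, Prod.fst_sum, Prod.snd_sum, Finset.sum_apply, Pi.single_apply]
  rw [hx, zlen, mul_add, Finset.mul_sum, Finset.mul_sum]
  refine (hNadd _ _).trans (add_le_add ?_ ?_) <;>
  · refine (Finset.le_sum_of_subadditive N hN00.le hNadd _ _).trans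
      (Finset.sum_le_sum fun i _ => ?_)
    rw [hNsmul, mul_comm]
    gcongr
    first | exact hB1 i | exact hB2 i

variable {d : ℕ} {ω : (Fin d → ℝ) × (Fin d → ℝ) → ℝ}

theorem IsAdmissibleWeight2.one_le (h : IsAdmissibleWeight2 ω) (x : (Fin d → ℝ) × (Fin d → ℝ)) :
    1 ≤ ω x := by
  obtain ⟨⟨N, ρ, hN0, -, -, -, -, -, -, hρ, hω⟩, -⟩ := h
  rw [hω]
  exact Real.one_le_exp (hρ _ (hN0 x))

theorem IsAdmissibleWeight2.add_le_mul (h : IsAdmissibleWeight2 ω)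
    (x y : (Fin d → ℝ) × (Fin d → ℝ)) : ω (x + y) ≤ ω x * ω y := by
  obtain ⟨⟨N, ρ, hN0, -, hNadd, -, -, hconc, hρ0, hρ, hω⟩, -⟩ := h
  rw [hω, hω, hω, ← Real.exp_add, Real.exp_le_exp]
  exact (hconc.monotoneOn_of_nonneg hρ (hN0 _) (add_nonneg (hN0 x) (hN0 y)) (hNadd x y)).trans
    (hconc.add_le_of_map_zero hρ0 (hN0 x) (hN0 y))

/-- The GRS-condition forces subexponential growth. -/
theorem IsAdmissibleWeight2.exists_le_exp (h : IsAdmissibleWeight2 ω) {η : ℝ} (hη : 0 < η) :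
    ∃ C, ∀ x : (Fin d → ℤ) × (Fin d → ℤ), ω (zr2 x) ≤ Real.exp (η * zlen x + C) := by
  obtain ⟨⟨N, ρ, hN0, hNeq, hNadd, hNsmul, -, hconc, hρ0, hρ, hω⟩, hgrs⟩ := h
  rcases isEmpty_or_nonempty (Fin d) with hd | ⟨⟨i⟩⟩
  · refine ⟨0, fun x => ?_⟩
    rw [hω, Real.exp_le_exp, (hNeq _).2 (Subsingleton.elim _ _), hρ0, add_zero]
    exact mul_nonneg hη.le (zlen_nonneg x)
  have hmono := hconc.monotoneOn_of_nonneg hρ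
  set x₀ : (Fin d → ℝ) × (Fin d → ℝ) := (Pi.single i 1, 0) with hx₀
  have hx₀N : 0 < N x₀ := (hN0 _).lt_of_ne' fun h0 => by
    have := congrFun (congrArg Prod.fst ((hNeq _).1 h0)) i
    simp [hx₀] at this
  have hlim : Tendsto (fun n : ℕ => ρ (n * N x₀) / n) atTop (nhds 0) := by
    have h1 := ((Real.continuousAt_log one_ne_zero).tendsto).comp (hgrs x₀)
    rw [Real.log_one] at h1
    refine h1.congr fun n => ?_
    rw [Function.comp_apply, hω, ← Real.exp_mul, Real.log_exp, hNsmul, Nat.abs_cast, div_eq_mul_inv]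
  obtain ⟨B, hB, hNB⟩ := exists_le_mul_zlen hNadd hNsmul hN0
  obtain ⟨C, hC⟩ := exists_le_mul_add_of_tendsto hmono hx₀N hlim (div_pos hη hB)
  refine ⟨C, fun x => ?_⟩
  rw [hω, Real.exp_le_exp]
  refine (hC _ (hN0 _)).trans (add_le_add_left ?_ C)
  calc η / B * N (zr2 x) ≤ η / B * (B * zlen x) := by gcongr; exact hNB x
    _ = η * zlen x := by field_simp

theorem IsAdmissibleWeight2.summable_exp_mul (h : IsAdmissibleWeight2 ω) {p : ℝ} (hp0 : 0 < p)
    {ε : ℝ} (hε : 0 < ε) :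
    Summable fun x : (Fin d → ℤ) × (Fin d → ℤ) =>
      Real.exp (-(ε * zlen x)) ^ p * ω (zr2 x) ^ p := by
  obtain ⟨C, hC⟩ := h.exists_le_exp (half_pos hε)
  have hω0 : ∀ x, 0 ≤ ω x := fun x => zero_le_one.trans (h.one_le x)
  refine Summable.of_nonneg_of_le
    (fun x => mul_nonneg (by positivity) (Real.rpow_nonneg (hω0 _) _)) (fun x => ?_)
    ((summable_exp_neg_mul_zlen (d := d) (mul_pos hp0 (half_pos hε))).mul_left (Real.exp (C * p)))
  calc Real.exp (-(ε * zlen x)) ^ p * ω (zr2 x) ^ p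
      ≤ Real.exp (-(ε * zlen x)) ^ p * Real.exp (ε / 2 * zlen x + C) ^ p := by
        have := hω0 (zr2 x)
        gcongr
        exact hC x
    _ = Real.exp (C * p) * Real.exp (-(p * (ε / 2) * zlen x)) := by
        rw [← Real.exp_mul, ← Real.exp_mul, ← Real.exp_add, ← Real.exp_add]
        ring_nf

end Weight

section TwistedConvolution

variable {d : ℕ} {θ : ℝ}

theorem norm_e2 (θ : ℝ) (x : ℤ) : ‖e2 θ x‖ = 1 := by
  rw [e2, Complex.norm_exp, Real.exp_eq_one_iff]
  simp

theorem e2_add (θ : ℝ) (x y : ℤ) : e2 θ (x + y) = e2 θ x * e2 θ y := by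
  rw [e2, e2, e2, ← Complex.exp_add]
  push_cast
  ring_nf

theorem e2_zero (θ : ℝ) : e2 θ 0 = 1 := by simp [e2]

theorem zdot_cocycle (X u v : (Fin d → ℤ) × (Fin d → ℤ)) :
    zdot (X.1 - u.1 - v.1) v.2 + zdot (X.1 - u.1) u.2 =
      zdot v.1 u.2 + zdot (X.1 - u.1 - v.1) (u.2 + v.2) := by
  simp only [zdot, ← Finset.sum_add_distrib, Pi.sub_apply, Pi.add_apply]
  exact Finset.sum_congr rfl fun i _ => by ring

theorem summable_norm_tconv {a b : (Fin d → ℤ) × (Fin d → ℤ) → ℂ}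
    (ha : Summable fun u => ‖a u‖) (hb : Summable fun u => ‖b u‖) :
    Summable fun u => ‖tconv θ a b u‖ := by
  have h1 := ha.mul_of_nonneg hb (fun _ => norm_nonneg _) (fun _ => norm_nonneg _)
  have h2 : Summable fun q : ((Fin d → ℤ) × (Fin d → ℤ)) × ((Fin d → ℤ) × (Fin d → ℤ)) =>
      ‖a q.2 * b (q.1 - q.2) * e2 θ (zdot (q.1.1 - q.2.1) q.2.2)‖ := by
    rw [← (Equiv.prodComm _ _).summable_iff,
      ← (Equiv.prodShear (Equiv.refl _) fun u => Equiv.addRight u).summable_iff]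
    refine h1.congr fun q => ?_
    simp [norm_e2]
  refine Summable.of_nonneg_of_le (fun _ => norm_nonneg _) (fun x => ?_) h2.prod
  exact norm_tsum_le_tsum_norm (h2.prod_factor x)

theorem tconv_assoc {a b c : (Fin d → ℤ) × (Fin d → ℤ) → ℂ}
    (ha : Summable fun u => ‖a u‖) (hb : Summable fun u => ‖b u‖) (hc : Summable fun u => ‖c u‖) :
    tconv θ a (tconv θ b c) = tconv θ (tconv θ a b) c := by
  funext X
  let H : (Fin d → ℤ) × (Fin d → ℤ) → (Fin d → ℤ) × (Fin d → ℤ) → ℂ := fun u v =>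
    a u * b v * c (X - u - v) * e2 θ (zdot (X.1 - u.1 - v.1) v.2 + zdot (X.1 - u.1) u.2)
  have hH : Summable (Function.uncurry H) := by
    refine Summable.of_norm_bounded ((ha.mul_of_nonneg hb (fun _ => norm_nonneg _)
      (fun _ => norm_nonneg _)).mul_right (∑' x, ‖c x‖)) fun q => ?_
    simp only [Function.uncurry, H, norm_mul, norm_e2, mul_one]
    gcongr
    exact hc.le_tsum _ fun _ _ => norm_nonneg _
  have hH' : Summable (Function.uncurry fun u z => H u (z - u)) := by
    rw [← (Equiv.prodShear (Equiv.refl _) fun u => Equiv.addRight u).summable_iff]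
    refine hH.congr fun q => ?_
    simp [Function.uncurry]
  calc tconv θ a (tconv θ b c) X = ∑' u, ∑' v, H u v := by
        refine tsum_congr fun u => ?_
        rw [tconv, ← tsum_mul_left, ← tsum_mul_right]
        refine tsum_congr fun v => ?_
        simp only [H, e2_add, Prod.fst_sub]
        ring
    _ = ∑' u, ∑' z, H u (z - u) :=
        tsum_congr fun u => ((Equiv.subRight u).tsum_eq (H u)).symm
    _ = ∑' z, ∑' u, H u (z - u) := hH'.tsum_comm.symm
    _ = tconv θ (tconv θ a b) c X := by
        refine tsum_congr fun z => ?_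
        rw [tconv, ← tsum_mul_right, ← tsum_mul_right]
        refine tsum_congr fun u => ?_
        simp only [H]
        have h1 : X - u - (z - u) = X - z := by abel
        have h2 : X.1 - u.1 - (z.1 - u.1) = X.1 - z.1 := by abel
        have h3 : u.2 + (z.2 - u.2) = z.2 := by abel
        rw [zdot_cocycle, e2_add, Prod.fst_sub, Prod.snd_sub, h1, h2, h3]
        ring

theorem tconv_delta (a : (Fin d → ℤ) × (Fin d → ℤ) → ℂ) :
    tconv θ a (fun mn => if mn = 0 then (1 : ℂ) else 0) = a := by
  funext x
  rw [tconv, tsum_eq_single x]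
  · simp [zdot, e2_zero]
  · intro u hu
    simp [sub_eq_zero, hu.symm]

theorem delta_tconv (a : (Fin d → ℤ) × (Fin d → ℤ) → ℂ) :
    tconv θ (fun mn => if mn = 0 then (1 : ℂ) else 0) a = a := by
  funext x
  rw [tconv, tsum_eq_single 0]
  · simp [zdot, e2_zero]
  · intro u hu
    simp [hu]

end TwistedConvolution

/-- **Wiener's lemma for twisted convolution.**  Let `0 < p ≤ 1`, `θ > 0`, `ω` an
admissible weight on `ℤ^{2d}` with the weak growth condition, and `a ∈ ℓ^p(ℤ^{2d}, ω)`.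
If the twisted convolution operator `L_a` is invertible on `ℓ²(ℤ^{2d})`, then there is
`b ∈ ℓ^p(ℤ^{2d}, ω)` with `L_a⁻¹ = L_b`; equivalently `a ⋆_θ b = b ⋆_θ a = δ₀`. -/
theorem wiener_lemma_twisted_convolution
    {d : ℕ} (p : ℝ) (hp0 : 0 < p) (hp1 : p ≤ 1) (θ : ℝ) (hθ : 0 < θ)
    (ω : (Fin d → ℝ) × (Fin d → ℝ) → ℝ)
    (hadm : IsAdmissibleWeight2 ω) (hwg : WeakGrowth2 ω)
    (a : (Fin d → ℤ) × (Fin d → ℤ) → ℂ)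
    (ha : Summable fun kl : (Fin d → ℤ) × (Fin d → ℤ) => ‖a kl‖ ^ p * ω (zr2 kl) ^ p)
    (T : lp (fun _ : (Fin d → ℤ) × (Fin d → ℤ) => ℂ) 2 →L[ℂ]
         lp (fun _ : (Fin d → ℤ) × (Fin d → ℤ) => ℂ) 2)
    (hT : ∀ (f : lp (fun _ : (Fin d → ℤ) × (Fin d → ℤ) => ℂ) 2)
        (mn : (Fin d → ℤ) × (Fin d → ℤ)),
      T f mn = ∑' kl : (Fin d → ℤ) × (Fin d → ℤ),
        a kl * f (mn - kl) * e2 θ (zdot (mn.1 - kl.1) kl.2))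
    (hinv : IsUnit T) :
    ∃ b : (Fin d → ℤ) × (Fin d → ℤ) → ℂ,
      (Summable fun kl : (Fin d → ℤ) × (Fin d → ℤ) => ‖b kl‖ ^ p * ω (zr2 kl) ^ p) ∧
      tconv θ a b = (fun mn => if mn = 0 then (1 : ℂ) else 0) ∧
      tconv θ b a = (fun mn => if mn = 0 then (1 : ℂ) else 0) := by
  obtain ⟨U, hU⟩ := hinv
  set S : lp (fun _ : (Fin d → ℤ) × (Fin d → ℤ) => ℂ) 2 →L[ℂ]
    lp (fun _ : (Fin d → ℤ) × (Fin d → ℤ) => ℂ) 2 := U⁻¹.val with hS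
  have hST : ∀ g, S (T g) = g := fun g => by
    rw [← hU]; exact DFunLike.congr_fun U.inv_mul g
  have hTS : ∀ g, T (S g) = g := fun g => by
    rw [← hU]; exact DFunLike.congr_fun U.mul_inv g
  have hw1 : ∀ x : (Fin d → ℤ) × (Fin d → ℤ), 1 ≤ ω (zr2 x) := fun x => hadm.one_le _
  have hsingle : ⇑(lp.single 2 0 1 : lp (fun _ : (Fin d → ℤ) × (Fin d → ℤ) => ℂ) 2) =
      fun mn => if mn = 0 then (1 : ℂ) else 0 := by
    funext x
    rcases eq_or_ne x 0 with rfl | hx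
    · simp
    · simp [hx]
  have hTconv : ∀ f, ⇑(T f) = tconv θ a f := fun f => funext fun x => hT f x
  set f := S (lp.single 2 0 1) with hf
  have hfsum : Summable fun u => ‖f u‖ ^ p * ω (zr2 u) ^ p :=
    summable_rpow_mul_of_apply_eq_single (len := zlen) (C := ‖S‖) hp0 hp1 (by simp [zlen])
      (fun x => by simp [zlen]) zlen_add_le hw1
      (fun x y => by
        have h : zr2 (x + y) = zr2 x + zr2 y := by
          refine Prod.ext ?_ ?_ <;> funext i <;> simp [zr2]
        rw [h]
        exact hadm.add_le_mul _ _)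
      (fun ε hε => hadm.summable_exp_mul hp0 hε)
      (σ := fun x u => e2 θ (zdot (x.1 - u.1) u.2)) (fun x u => norm_e2 _ _) ha
      (T := T) (fun f x => hT f x) (norm_nonneg _)
      (fun g => by simpa only [hST] using S.le_opNorm (T g)) (hTS _)
  have ha1 := summable_norm_of_summable_rpow_mul hp0 hp1 hw1 ha
  have hf1 := summable_norm_of_summable_rpow_mul hp0 hp1 hw1 hfsum
  have haf : tconv θ a f = fun mn => if mn = 0 then (1 : ℂ) else 0 := by
    rw [← hTconv, hf, hTS, hsingle]
  refine ⟨f, hfsum, haf, ?_⟩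
  have hmem : Memℓp (tconv θ f a) 2 :=
    (memℓp_gen (p := 1) (by simpa using summable_norm_tconv hf1 ha1)).of_exponent_ge
      (by norm_num)
  have hT_eq : T ⟨tconv θ f a, hmem⟩ = T (lp.single 2 0 1) := by
    apply lp.ext
    rw [hTconv, hTconv, hsingle, tconv_delta]
    exact (tconv_assoc ha1 hf1 ha1).trans (by rw [haf, delta_tconv])
  have hg := congrArg S hT_eq
  rw [hST, hST] at hg
  rw [← hsingle, ← hg]
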